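/- arXiv:1405.6636 — 3 statements merged into one kernel-verified Lean document; each statement's English description precedes it below -/
import Mathlib

section
/- Suppose the feasible set of the K-base-station spectrum allocation problem is nonempty. Then there exists a feasible allocation x* minimizing the objective f over all feasible allocations such that the number of subsets B ⊆ S with x*(B) ≠ 0 is at most K; that is, the optimal solution divides the spectrum into at most K segments. -/
open Finset

noncomputable section

/-- Service rate of base station `i` induced by spectrum allocation `x`,
    where `s i B` is the spectral efficiency of station `i` on spectrum shared by `B`. -/
def rate {K : ℕ} (s : Fin K → Finset (Fin K) → ℝ) (x : Finset (Fin K) → ℝ) (i : Fin K) : ℝ :=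
  ∑ B : Finset (Fin K), s i B * x B

/-- A feasible spectrum allocation: nonnegative, sums to one, and every queue is stable. -/
def Feasible {K : ℕ} (s : Fin K → Finset (Fin K) → ℝ) (lam : Fin K → ℝ)
    (x : Finset (Fin K) → ℝ) : Prop :=
  (∀ B, 0 ≤ x B) ∧ (∑ B : Finset (Fin K), x B = 1) ∧ (∀ i, lam i < rate s x i)

/-- Conservative weighted mean packet sojourn time. -/
def obj {K : ℕ} (s : Fin K → Finset (Fin K) → ℝ) (lam : Fin K → ℝ)
    (x : Finset (Fin K) → ℝ) : ℝ :=
  ∑ i : Fin K, (lam i / ∑ j : Fin K, lam j) / (rate s x i - lam i)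

lemma obj_le_of_rate_le {K : ℕ} {s : Fin K → Finset (Fin K) → ℝ} {lam : Fin K → ℝ}
    (hlam : ∀ i, 0 < lam i) {x y : Finset (Fin K) → ℝ} (hx : Feasible s lam x)
    (h : ∀ i, rate s x i ≤ rate s y i) : obj s lam y ≤ obj s lam x := by
  refine Finset.sum_le_sum fun i _ => ?_
  have hw : 0 ≤ lam i / ∑ j : Fin K, lam j :=
    div_nonneg (hlam i).le (Finset.sum_nonneg fun j _ => (hlam j).le)
  exact div_le_div_of_nonneg_left hw (sub_pos.2 (hx.2.2 i)) (sub_le_sub_right (h i) _)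

/-- More than `K` columns of a `K`-row table satisfy a nontrivial linear relation. -/
lemma exists_relation_of_card_lt {K : ℕ} {α : Type*} [Fintype α] (s : Fin K → α → ℝ)
    (T : Finset α) (hT : K < T.card) :
    ∃ d : α → ℝ, d ≠ 0 ∧ (∀ a ∉ T, d a = 0) ∧ ∀ i, ∑ a, s i a * d a = 0 := by
  classical
  let M : Matrix (Fin K) T ℝ := fun i a => s i a
  have hker : LinearMap.ker M.mulVecLin ≠ ⊥ :=
    LinearMap.ker_ne_bot_of_finrank_lt (by simpa using hT)
  obtain ⟨v, hv, hv0⟩ := Submodule.exists_mem_ne_zero_of_ne_bot hker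
  refine ⟨fun a => if h : a ∈ T then v ⟨a, h⟩ else 0, ?_, fun a ha => by simp [ha], fun i => ?_⟩
  · intro h
    refine hv0 (funext fun a => ?_)
    simpa using congrFun h a.1
  · have hi : ∑ a : T, s i a * v a = 0 := congrFun (LinearMap.mem_ker.1 hv) i
    rw [← Finset.sum_subset (Finset.subset_univ T) (fun a _ ha => by simp [ha]),
      ← Finset.sum_coe_sort, ← hi]
    exact Finset.sum_congr rfl fun a _ => by simp

/-- Moving from a nonnegative `x` along a direction with a negative entry, supported in the
support of `x`, until a coordinate vanishes. -/
lemma exists_step_vanishing {α : Type*} [Fintype α] {x d : α → ℝ} (hx : ∀ a, 0 ≤ x a)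
    (hd : ∀ a, x a = 0 → d a = 0) (hneg : ∃ a, d a < 0) :
    ∃ t : ℝ, 0 ≤ t ∧ (∀ a, 0 ≤ x a + t * d a) ∧ ∃ a, x a ≠ 0 ∧ x a + t * d a = 0 := by
  classical
  obtain ⟨a₀, h₀⟩ := hneg
  obtain ⟨b, hb, hmin⟩ := (Finset.univ.filter fun a => d a < 0).exists_min_image
    (fun a => x a / -d a) ⟨a₀, by simp [h₀]⟩
  have hb : d b < 0 := by simpa using hb
  have ht : 0 ≤ x b / -d b := div_nonneg (hx b) (by linarith)
  refine ⟨x b / -d b, ht, fun a => ?_, b, fun h => hb.ne (hd b h), ?_⟩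
  · rcases lt_or_ge (d a) 0 with ha | ha
    · have h := hmin a (by simp [ha])
      rw [le_div_iff₀ (by linarith)] at h
      linarith
    · exact add_nonneg (hx a) (mul_nonneg ht ha)
  · have := hb.ne
    field_simp
    ring

lemma exists_feasible_support_ssubset {K : ℕ} (hK : 1 ≤ K)
    {s : Fin K → Finset (Fin K) → ℝ} {lam : Fin K → ℝ} (hlam : ∀ i, 0 < lam i)
    {x : Finset (Fin K) → ℝ} (hx : Feasible s lam x)
    (hcard : K < {B : Finset (Fin K) | x B ≠ 0}.ncard) :
    ∃ y, Feasible s lam y ∧ obj s lam y ≤ obj s lam x ∧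
      {B : Finset (Fin K) | y B ≠ 0} ⊂ {B : Finset (Fin K) | x B ≠ 0} := by
  classical
  obtain ⟨d, hd0, hdT, hdr, hds⟩ : ∃ d : Finset (Fin K) → ℝ, d ≠ 0 ∧ (∀ B, x B = 0 → d B = 0) ∧
      (∀ i, ∑ B, s i B * d B = 0) ∧ ∑ B, d B ≤ 0 := by
    obtain ⟨d, hd0, hdT, hdr⟩ := exists_relation_of_card_lt s
      (Finset.univ.filter fun B => x B ≠ 0) (by simpa [Set.ncard_eq_toFinset_card'] using hcard)
    rcases le_total (∑ B, d B) 0 with h | h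
    · exact ⟨d, hd0, fun B hB => hdT B (by simp [hB]), hdr, h⟩
    · exact ⟨-d, neg_ne_zero.2 hd0, fun B hB => by simp [hdT B (by simp [hB])],
        fun i => by simp [hdr i], by simpa using h⟩
  have hneg : ∃ B, d B < 0 := by
    by_contra! h
    have h0 : ∑ B, d B = 0 := le_antisymm hds (Finset.sum_nonneg fun B _ => h B)
    exact hd0 (funext fun B =>
      (Finset.sum_eq_zero_iff_of_nonneg fun B _ => h B).1 h0 B (Finset.mem_univ B))
  obtain ⟨t, ht, hnn, b, hxb, hb⟩ := exists_step_vanishing hx.1 hdT hneg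
  set y : Finset (Fin K) → ℝ := fun B => x B + t * d B with hy
  have hrate : ∀ i, rate s y i = rate s x i := fun i => by
    have h : ∑ B, s i B * (t * d B) = t * ∑ B, s i B * d B := by
      rw [Finset.mul_sum]; exact Finset.sum_congr rfl fun B _ => by ring
    simp only [rate, hy, mul_add, Finset.sum_add_distrib, h, hdr i, mul_zero, add_zero]
  have hc1 : ∑ B, y B ≤ 1 := by
    have : ∑ B, y B = 1 + t * ∑ B, d B := by
      simp only [hy, Finset.sum_add_distrib, ← Finset.mul_sum, hx.2.1]
    nlinarith
  have hc0 : 0 < ∑ B, y B := by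
    refine (Finset.sum_nonneg fun B _ => hnn B).lt_of_ne' fun h => ?_
    have hz := (Finset.sum_eq_zero_iff_of_nonneg fun B _ => hnn B).1 h
    have hr : rate s y ⟨0, hK⟩ = 0 :=
      Finset.sum_eq_zero fun B _ => by rw [show y B = 0 from hz B (Finset.mem_univ B), mul_zero]
    have := hx.2.2 ⟨0, hK⟩
    have := hlam ⟨0, hK⟩
    have := hrate ⟨0, hK⟩
    linarith
  set c := ∑ B, y B with hc
  have hscale : ∀ i, rate s x i ≤ rate s (fun B => y B / c) i := fun i => by
    have h : rate s (fun B => y B / c) i = rate s x i / c := by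
      rw [← hrate i]
      simp only [rate, Finset.sum_div, mul_div_assoc]
    rw [h]
    exact le_div_self ((hlam i).trans (hx.2.2 i)).le hc0 hc1
  refine ⟨fun B => y B / c, ⟨fun B => div_nonneg (hnn B) hc0.le, ?_,
    fun i => (hx.2.2 i).trans_le (hscale i)⟩, obj_le_of_rate_le hlam hx hscale, ?_⟩
  · rw [← Finset.sum_div, ← hc, div_self hc0.ne']
  · refine (Set.ssubset_iff_of_subset ?_).2 ⟨b, hxb, ?_⟩
    · intro B hB hxB
      exact hB (by simp [hy, hxB, hdT B hxB])
    · simp [hy, hb]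

lemma exists_feasible_ncard_support_le {K : ℕ} (hK : 1 ≤ K)
    {s : Fin K → Finset (Fin K) → ℝ} {lam : Fin K → ℝ} (hlam : ∀ i, 0 < lam i)
    {x : Finset (Fin K) → ℝ} (hx : Feasible s lam x) :
    ∃ y, Feasible s lam y ∧ obj s lam y ≤ obj s lam x ∧
      {B : Finset (Fin K) | y B ≠ 0}.ncard ≤ K := by
  induction hn : {B : Finset (Fin K) | x B ≠ 0}.ncard using Nat.strong_induction_on
    generalizing x with
  | _ n ih =>
    rcases le_or_gt n K with h | h
    · exact ⟨x, hx, le_rfl, hn.trans_le h⟩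
    · obtain ⟨y, hy, hyx, hss⟩ := exists_feasible_support_ssubset hK hlam hx (hn ▸ h)
      obtain ⟨z, hz, hzy, hzK⟩ := ih _ (hn ▸ Set.ncard_lt_ncard hss (Set.toFinite _)) hy rfl
      exact ⟨z, hz, hzy.trans hyx, hzK⟩

lemma continuous_rate {K : ℕ} (s : Fin K → Finset (Fin K) → ℝ) (i : Fin K) :
    Continuous fun x => rate s x i := by
  unfold rate
  fun_prop

lemma exists_feasible_minimizer {K : ℕ} {s : Fin K → Finset (Fin K) → ℝ}
    {lam : Fin K → ℝ} (hlam : ∀ i, 0 < lam i) (hne : ∃ x, Feasible s lam x) :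
    ∃ y, Feasible s lam y ∧ ∀ x, Feasible s lam x → obj s lam y ≤ obj s lam x := by
  obtain ⟨x₀, hx₀⟩ := hne
  have hw : ∀ i, 0 < lam i / ∑ j : Fin K, lam j := fun i =>
    div_pos (hlam i) (Finset.sum_pos (fun j _ => hlam j) ⟨i, Finset.mem_univ i⟩)
  have hterm : ∀ x, Feasible s lam x → ∀ i,
      0 < (lam i / ∑ j : Fin K, lam j) / (rate s x i - lam i) ∧
      (lam i / ∑ j : Fin K, lam j) / (rate s x i - lam i) ≤ obj s lam x := fun x hx i => by
    have hpos : ∀ j, 0 < (lam j / ∑ k : Fin K, lam k) / (rate s x j - lam j) :=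
      fun j => div_pos (hw j) (sub_pos.2 (hx.2.2 j))
    exact ⟨hpos i, Finset.single_le_sum (f := fun j =>
      (lam j / ∑ k : Fin K, lam k) / (rate s x j - lam j))
      (fun j _ => (hpos j).le) (Finset.mem_univ i)⟩
  -- Off this compact set a feasible allocation is worse than `x₀`.
  let C : Set (Finset (Fin K) → ℝ) := stdSimplex ℝ (Finset (Fin K)) ∩
    ⋂ i, {x | lam i + (lam i / ∑ j : Fin K, lam j) / obj s lam x₀ ≤ rate s x i}
  have hC : IsCompact C := (isCompact_stdSimplex ℝ (Finset (Fin K))).inter_right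
    (isClosed_iInter fun i => isClosed_le continuous_const (continuous_rate s i))
  have hmem : ∀ x, Feasible s lam x → obj s lam x ≤ obj s lam x₀ → x ∈ C := fun x hx hle => by
    refine ⟨⟨hx.1, hx.2.1⟩, Set.mem_iInter.2 fun i => ?_⟩
    have h₀ : 0 < obj s lam x₀ := (hterm x hx i).1.trans_le ((hterm x hx i).2.trans hle)
    have h := (hterm x hx i).2.trans hle
    rw [div_le_comm₀ (sub_pos.2 (hx.2.2 i)) h₀] at h
    exact le_sub_iff_add_le'.1 h
  have hfeas : ∀ x ∈ C, Feasible s lam x := fun x hx => by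
    refine ⟨hx.1.1, hx.1.2, fun i => ?_⟩
    have h₀ := (hterm x₀ hx₀ i).1.trans_le (hterm x₀ hx₀ i).2
    have := Set.mem_iInter.1 hx.2 i
    exact (lt_add_of_pos_right _ (div_pos (hw i) h₀)).trans_le this
  have hcont : ContinuousOn (obj s lam) C :=
    continuousOn_finsetSum _ fun i _ => continuousOn_const.div
      ((continuous_rate s i).sub continuous_const).continuousOn
      fun x hx => (sub_pos.2 ((hfeas x hx).2.2 i)).ne'
  have hx₀C := hmem x₀ hx₀ le_rfl
  obtain ⟨y, hy, hmin⟩ := hC.exists_isMinOn ⟨x₀, hx₀C⟩ hcont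
  refine ⟨y, hfeas y hy, fun x hx => ?_⟩
  rcases le_total (obj s lam x) (obj s lam x₀) with h | h
  · exact hmin (hmem x hx h)
  · exact (hmin hx₀C).trans h

/-- If the feasible set is nonempty, some minimizer of the objective
uses at most K spectrum segments. -/
theorem optimal_at_most_K_segments {K : ℕ} (hK : 1 ≤ K)
    (s : Fin K → Finset (Fin K) → ℝ)
    (hs : ∀ i B, 0 ≤ s i B)
    (hs0 : ∀ i B, i ∉ B → s i B = 0)
    (lam : Fin K → ℝ) (hlam : ∀ i, 0 < lam i)
    (hne : ∃ x, Feasible s lam x) :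
    ∃ xstar, Feasible s lam xstar ∧
      (∀ x, Feasible s lam x → obj s lam xstar ≤ obj s lam x) ∧
      {B : Finset (Fin K) | xstar B ≠ 0}.ncard ≤ K := by
  obtain ⟨x, hx, hmin⟩ := exists_feasible_minimizer hlam hne
  obtain ⟨y, hy, hyx, hcard⟩ := exists_feasible_ncard_support_le hK hlam hx
  exact ⟨y, hy, fun z hz => hyx.trans (hmin z hz), hcard⟩
end
end

section
/- Carathéodory bound for componentwise-maximal points: let K ≥ 1 and let P be a finite set of points in ℝ^K. Suppose r belongs to the convex hull of P and r is maximal in the convex hull of P with respect to the componentwise order, i.e., every p in the convex hull of P with r_i ≤ p_i for all i satisfies p = r. Then there exists a subset Q ⊆ P with |Q| ≤ K such that r belongs to the convex hull of Q. -/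
open Finset

/-- Carathéodory bound for componentwise-maximal points of the convex
hull of a finite set `P ⊆ ℝ^K`: such a point lies in the convex hull of at most `K`
points of `P`. -/
theorem caratheodory_of_maximal {K : ℕ} (hK : 1 ≤ K)
    (P : Finset (Fin K → ℝ)) (r : Fin K → ℝ)
    (hr : r ∈ convexHull ℝ (P : Set (Fin K → ℝ)))
    (hmax : ∀ p ∈ convexHull ℝ (P : Set (Fin K → ℝ)), (∀ i, r i ≤ p i) → p = r) :
    ∃ Q ⊆ P, Q.card ≤ K ∧ r ∈ convexHull ℝ (Q : Set (Fin K → ℝ)) := by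
  classical
  obtain ⟨ι, _, z, w, hzP, hz, hw, hw1, hwr⟩ := eq_pos_convex_span_of_mem_convexHull hr
  rcases le_or_gt (Fintype.card ι) K with hcard | hcard
  · refine ⟨univ.image z, ?_, card_image_le.trans hcard, ?_⟩
    · intro x hx
      obtain ⟨i, -, rfl⟩ := mem_image.1 hx
      exact hzP ⟨i, rfl⟩
    · rw [← hwr]
      exact (convex_convexHull ℝ _).sum_mem (fun i _ => (hw i).le) hw1
        fun i _ => subset_convexHull ℝ _ (by simp)
  · exfalso
    have hcard' : Fintype.card ι = Module.finrank ℝ (Fin K → ℝ) + 1 := by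
      have h1 := hz.card_le_finrank_succ
      have h2 := (vectorSpan ℝ (Set.range z)).finrank_le
      rw [Module.finrank_fin_fun] at h2 ⊢
      omega
    let b : AffineBasis ι ℝ (Fin K → ℝ) :=
      ⟨z, hz, hz.affineSpan_eq_top_iff_card_eq_finrank_add_one.2 hcard'⟩
    have hint : r ∈ interior (convexHull ℝ (Set.range b)) := by
      rw [b.interior_convexHull]
      intro i
      have hcomb : univ.affineCombination ℝ b w = r := by
        rw [univ.affineCombination_eq_linear_combination _ _ hw1]
        exact hwr
      rw [← hcomb, b.coord_apply_combination_of_mem (mem_univ i) hw1]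
      exact hw i
    have htend : Filter.Tendsto (fun ε : ℝ => r + ε • (1 : Fin K → ℝ))
        (nhdsWithin 0 (Set.Ioi 0)) (nhds r) := by
      have hcont : Continuous fun ε : ℝ => r + ε • (1 : Fin K → ℝ) := by fun_prop
      simpa using (hcont.tendsto 0).mono_left nhdsWithin_le_nhds
    obtain ⟨ε, hεmem, hε⟩ :=
      ((htend.eventually (mem_interior_iff_mem_nhds.1 hint)).and self_mem_nhdsWithin).exists
    have hε0 : 0 < ε := hε
    have heq := hmax _ (convexHull_mono hzP hεmem) fun i => by simp [hε0.le]
    have h0 := congrFun heq ⟨0, hK⟩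
    simp [hε0.ne'] at h0
end

section
/- The set of achievable rate vectors is the convex hull of the spectral-efficiency vectors, and every maximal achievable rate vector uses at most K segments: for K ≥ 1 and any spectrum allocation x, the vector (r_1(x),…,r_K(x)) lies in the convex hull of the finite set {(s_1(B),…,s_K(B)) : B ⊆ S}; moreover, if (r_1(x),…,r_K(x)) is maximal in this convex hull with respect to the componentwise order, then there exists a spectrum allocation y with at most K subsets B satisfying y(B) ≠ 0 such that r_i(y) = r_i(x) for all i ∈ S. -/
open Finset

noncomputable section

/-- A refinement of Carathéodory's theorem: if a point of the convex hull of `s` cannot be moved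
in some direction `v` without leaving the hull, then it is a convex combination of at most
`finrank ℝ E` points of `s`. -/
theorem exists_convex_combination_card_le_finrank.{u} {E : Type u} [AddCommGroup E]
    [Module ℝ E] [FiniteDimensional ℝ E] {s : Set E} {x v : E} (hx : x ∈ convexHull ℝ s)
    (hv : ∀ ε : ℝ, 0 < ε → x + ε • v ∉ convexHull ℝ s) :
    ∃ (ι : Type u) (_ : Fintype ι) (z : ι → E) (w : ι → ℝ), Set.range z ⊆ s ∧ (∀ i, 0 < w i) ∧
      ∑ i, w i = 1 ∧ ∑ i, w i • z i = x ∧ Fintype.card ι ≤ Module.finrank ℝ E := by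
  obtain ⟨ι, _, z, w, hz, hind, hw, hw1, rfl⟩ := eq_pos_convex_span_of_mem_convexHull hx
  refine ⟨ι, inferInstance, z, w, hz, hw, hw1, rfl, ?_⟩
  by_contra! hcard
  have hle := hind.card_le_finrank_succ
  have hle' := Submodule.finrank_le (vectorSpan ℝ (Set.range z))
  have htop : vectorSpan ℝ (Set.range z) = ⊤ :=
    hind.vectorSpan_eq_top_of_card_eq_finrank_add_one (by omega)
  have hvmem : v ∈ vectorSpan ℝ (Set.range z) := htop ▸ Submodule.mem_top
  obtain ⟨g, hg0, hgv⟩ : ∃ g : ι → ℝ, ∑ i, g i = 0 ∧ v = ∑ i, g i • z i := by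
    classical
    obtain ⟨t, g, hg0, hgv⟩ := (mem_vectorSpan_iff_eq_weightedVSub ℝ).1 hvmem
    refine ⟨fun i => if i ∈ t then g i else 0, by simpa using hg0, ?_⟩
    rw [hgv, Finset.weightedVSub_eq_linear_combination t hg0]
    simp [ite_smul]
  obtain ⟨ε, hε, hεw⟩ : ∃ ε : ℝ, 0 < ε ∧ ∀ i, 0 ≤ w i + ε * g i := by
    have hev : ∀ᶠ ε : ℝ in nhdsWithin 0 (Set.Ioi 0), ∀ i, 0 < w i + ε * g i := by
      refine Filter.eventually_all.2 fun i => nhdsWithin_le_nhds ?_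
      have hc : Continuous fun ε : ℝ => w i + ε * g i := by fun_prop
      exact hc.continuousAt.eventually (lt_mem_nhds (by simpa using hw i))
    obtain ⟨ε, h, hε⟩ := (hev.and self_mem_nhdsWithin).exists
    exact ⟨ε, hε, fun i => (h i).le⟩
  refine hv ε hε ?_
  have hmem : ∑ i, (w i + ε * g i) • z i ∈ convexHull ℝ s :=
    (convex_convexHull ℝ s).sum_mem (fun i _ => hεw i)
      (by rw [sum_add_distrib, ← mul_sum, hw1, hg0, mul_zero, add_zero])
      (fun i _ => subset_convexHull ℝ s (hz ⟨i, rfl⟩))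
  simpa only [add_smul, mul_smul, sum_add_distrib, ← smul_sum, ← hgv] using hmem

/-- Achievable rate vectors lie in the convex hull of the
spectral-efficiency vectors, and every componentwise-maximal achievable rate vector can
be achieved by an allocation with at most `K` nonzero segments. -/
theorem rates_in_hull_and_maximal_uses_K_segments {K : ℕ} (hK : 1 ≤ K)
    (s : Fin K → Finset (Fin K) → ℝ)
    (hs : ∀ i B, 0 ≤ s i B)
    (hs0 : ∀ i B, i ∉ B → s i B = 0)
    (x : Finset (Fin K) → ℝ)
    (hx0 : ∀ B, 0 ≤ x B) (hx1 : ∑ B : Finset (Fin K), x B = 1) :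
    (fun i => rate s x i) ∈
      convexHull ℝ (Set.range fun B : Finset (Fin K) => fun i => s i B) ∧
    ((∀ p ∈ convexHull ℝ (Set.range fun B : Finset (Fin K) => fun i => s i B),
        (∀ i, rate s x i ≤ p i) → p = fun i => rate s x i) →
      ∃ y : Finset (Fin K) → ℝ,
        (∀ B, 0 ≤ y B) ∧ (∑ B : Finset (Fin K), y B = 1) ∧
        {B : Finset (Fin K) | y B ≠ 0}.ncard ≤ K ∧
        ∀ i, rate s y i = rate s x i) := by
  have hmem : (fun i => rate s x i) ∈
      convexHull ℝ (Set.range fun B : Finset (Fin K) => fun i => s i B) := by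
    have h : ∑ B, x B • (fun i => s i B) ∈
        convexHull ℝ (Set.range fun B : Finset (Fin K) => fun i => s i B) :=
      (convex_convexHull ℝ _).sum_mem (fun B _ => hx0 B) hx1
        (fun B _ => subset_convexHull ℝ _ ⟨B, rfl⟩)
    convert! h using 1
    ext i
    simp [rate, Finset.sum_apply, mul_comm]
  refine ⟨hmem, fun hmax => ?_⟩
  obtain ⟨ι, _, z, w, hz, hw, hw1, hwx, hcard⟩ :=
    exists_convex_combination_card_le_finrank (v := fun _ => (1 : ℝ)) hmem (by
      intro ε hε hp
      have heq := congrFun (hmax _ hp fun i => by simp [hε.le]) ⟨0, hK⟩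
      simp [hε.ne'] at heq)
  choose b hb using fun j => hz ⟨j, rfl⟩
  refine ⟨fun B => ∑ j with b j = B, w j, fun B => sum_nonneg fun j _ => (hw j).le, ?_, ?_, ?_⟩
  · rw [sum_fiberwise, hw1]
  · calc _ ≤ (univ.image b : Set (Finset (Fin K))).ncard := by
          refine Set.ncard_le_ncard (fun B hB => ?_) (Set.toFinite _)
          obtain ⟨j, hj, -⟩ := exists_ne_zero_of_sum_ne_zero hB
          simpa using ⟨j, (mem_filter.1 hj).2⟩
      _ ≤ Fintype.card ι := by
          rw [Set.ncard_coe_finset]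
          exact card_image_le
      _ ≤ K := by simpa using hcard
  · intro i
    calc _ = ∑ B, ∑ j with b j = B, s i (b j) * w j := by
          refine sum_congr rfl fun B _ => ?_
          rw [mul_sum]
          exact sum_congr rfl fun j hj => by rw [(mem_filter.1 hj).2]
      _ = ∑ j, s i (b j) * w j := sum_fiberwise _ _ _
      _ = ∑ j, w j * z j i := by
          refine sum_congr rfl fun j _ => ?_
          rw [← hb j, mul_comm]
      _ = rate s x i := by
          have := congrFun hwx i
          simpa [Finset.sum_apply] using this
end
end
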